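/- arXiv:1801.03442 — 4 statements merged into one kernel-verified Lean document; each statement's English description precedes it below -/
import Mathlib

section
/- Let n ≥ 3 be an integer. There exist constants C > 0 and ε₀ ∈ (0,1) such that for every ε ∈ (0, ε₀) there is a smooth function φ_ε : ℝ → ℝ with the following properties: φ_ε(x) = 1 for all x < ε²; φ_ε(x) = 0 for all x > ε; |φ_ε(x)| ≤ C for all x ∈ ℝ; |φ_ε′(x)| ≤ C/(x·|ln x|) for all x ∈ (0,1); and ∫₀^∞ φ_ε′(x)·x^{n−2} dx = 0. -/
open MeasureTheory

lemma aux_bump (m : ℕ) (hm : 1 ≤ m) : ∃ b : ℝ → ℝ, ContDiff ℝ (⊤ : ℕ∞) b ∧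
    HasCompactSupport b ∧
    (∀ x, x ≤ 1/2 → b x = 0) ∧ (∀ x, 1 ≤ x → b x = 0) ∧ (∀ x, |b x| ≤ 1) ∧
    (∃ B : ℝ, 0 < B ∧ ∀ x, |deriv b x| ≤ B) ∧
    (∫ x in Set.Ioi (0:ℝ), deriv b x * x ^ m) ≠ 0 := by
  let f : ContDiffBump (3/4 : ℝ) := ⟨1/8, 1/4, by norm_num, by norm_num⟩
  have hsm : ContDiff ℝ (⊤ : ℕ∞) f := f.contDiff
  have hd : Differentiable ℝ f := hsm.differentiable (by simp)
  have hdc : Continuous (deriv f) := hsm.continuous_deriv (by simp)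
  have hcs : HasCompactSupport f := f.hasCompactSupport
  have hlo : ∀ x : ℝ, x ≤ 1/2 → f x = 0 := by
    intro x hx
    apply f.zero_of_le_dist
    rw [Real.dist_eq]
    change (1/4 : ℝ) ≤ _
    rw [abs_of_nonpos (by linarith)]; linarith
  have hhi : ∀ x : ℝ, 1 ≤ x → f x = 0 := by
    intro x hx
    apply f.zero_of_le_dist
    rw [Real.dist_eq]
    change (1/4 : ℝ) ≤ _
    rw [abs_of_nonneg (by linarith)]; linarith
  refine ⟨f, hsm, hcs, hlo, hhi, ?_, ?_, ?_⟩
  · intro x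
    rw [abs_of_nonneg f.nonneg]; exact f.le_one
  · obtain ⟨B, hB⟩ := hdc.bounded_above_of_compact_support hcs.deriv
    exact ⟨max B 1, by positivity, fun x => (hB x).trans (le_max_left _ _)⟩
  · have h0 : (∫ x in Set.Ioi (0:ℝ), deriv f x * x ^ m) = ∫ x, deriv f x * x ^ m := by
      apply setIntegral_eq_integral_of_forall_compl_eq_zero
      intro x hx
      have hx : x ≤ 0 := by simpa using hx
      have : f =ᶠ[nhds x] fun _ => 0 := by
        filter_upwards [Iio_mem_nhds (show x < 1/2 by linarith)] with y hy
        exact hlo y (le_of_lt hy)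
      rw [this.deriv_eq]; simp
    rw [h0]
    have i1 : Integrable (fun x : ℝ => deriv f x * x ^ m) :=
      (hdc.mul (continuous_pow m)).integrable_of_hasCompactSupport hcs.deriv.mul_right
    have i2 : Integrable (fun x : ℝ => f x * (m * x ^ (m-1))) :=
      (hd.continuous.mul (by fun_prop)).integrable_of_hasCompactSupport hcs.mul_right
    have i3 : Integrable (fun x : ℝ => f x * x ^ m) :=
      (hd.continuous.mul (by fun_prop)).integrable_of_hasCompactSupport hcs.mul_right
    have key : ∫ x, (deriv f x * x ^ m + f x * (m * x ^ (m-1))) = 0 :=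
      integral_eq_zero_of_hasDerivAt_of_integrable
        (f := fun x => f x * x ^ m)
        (fun x => (hd x).hasDerivAt.mul (hasDerivAt_pow m x)) (i1.add i2) i3
    rw [integral_add i1 i2] at key
    have hnn : ∀ x : ℝ, 0 ≤ f x * (m * x ^ (m-1)) := by
      intro x
      rcases le_total x (1/2) with h | h
      · rw [hlo x h]; simp
      · have := f.nonneg (x := x)
        have hx : 0 ≤ x := by linarith
        positivity
    have hpos : 0 < ∫ x, f x * (m * x ^ (m-1)) := by
      apply Continuous.integral_pos_of_hasCompactSupport_nonneg_nonzero (x := 3/4)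
        (hd.continuous.mul (by fun_prop)) hcs.mul_right hnn
      have : f (3/4) = 1 := f.one_of_mem_closedBall (by simp [f.rIn_pos.le])
      rw [Pi.mul_apply, this]
      have : (0:ℝ) < m := by exact_mod_cast hm
      positivity
    intro h; linarith

lemma aux_base : ∃ K : ℝ, 0 < K ∧ ∀ ε ∈ Set.Ioo (0:ℝ) (1/2), ∃ φ : ℝ → ℝ,
    ContDiff ℝ (⊤ : ℕ∞) φ ∧ (∀ x, x ≤ ε ^ 2 → φ x = 1) ∧ (∀ x, ε ≤ x → φ x = 0) ∧
    (∀ x, |φ x| ≤ 1) ∧ ∀ x, 0 < x → |deriv φ x| ≤ K / (x * (-Real.log ε)) := by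
  have hsm : ContDiff ℝ (⊤ : ℕ∞) Real.smoothTransition := Real.smoothTransition.contDiff
  have hd : Differentiable ℝ Real.smoothTransition := hsm.differentiable (by simp)
  have hdc : Continuous (deriv Real.smoothTransition) := hsm.continuous_deriv (by simp)
  obtain ⟨K, hK⟩ := (isCompact_Icc (a := (0:ℝ)) (b := 1)).exists_bound_of_continuousOn
    hdc.continuousOn
  have hK' : ∀ t, |deriv Real.smoothTransition t| ≤ max K 1 := by
    intro t
    by_cases h0 : t < 0
    · have : Real.smoothTransition =ᶠ[nhds t] fun _ => 0 := by
        filter_upwards [Iio_mem_nhds h0] with y hy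
        exact Real.smoothTransition.zero_of_nonpos (le_of_lt hy)
      rw [this.deriv_eq]; simp
    by_cases h1 : 1 < t
    · have : Real.smoothTransition =ᶠ[nhds t] fun _ => 1 := by
        filter_upwards [Ioi_mem_nhds h1] with y hy
        exact Real.smoothTransition.one_of_one_le (le_of_lt hy)
      rw [this.deriv_eq]; simp
    · exact (hK t ⟨not_lt.1 h0, not_lt.1 h1⟩).trans (le_max_left _ _)
  refine ⟨max K 1, by positivity, ?_⟩
  rintro ε ⟨he0, he1⟩
  have hl : Real.log ε < 0 := Real.log_neg he0 (by linarith)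
  let g : ℝ → ℝ := fun x => Real.smoothTransition (Real.log x / Real.log ε - 1)
  let φ : ℝ → ℝ := fun x => if x ≤ 0 then 1 else g x
  have hg1 : ∀ x, x ≤ ε ^ 2 → φ x = 1 := by
    intro x hx
    by_cases h : x ≤ 0
    · simp [φ, h]
    · simp only [φ, h, if_false, g]
      apply Real.smoothTransition.one_of_one_le
      have : Real.log x ≤ 2 * Real.log ε := by
        have := Real.log_le_log (not_le.1 h) hx
        rwa [Real.log_pow] at this
      have : 2 ≤ Real.log x / Real.log ε := by rw [le_div_iff_of_neg hl]; exact this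
      linarith
  have hpos : ∀ x, 0 < x → φ =ᶠ[nhds x] g := by
    intro x hx
    filter_upwards [Ioi_mem_nhds hx] with y hy
    simp [φ, not_le.2 (show 0 < y from hy)]
  have hgs : ∀ x, 0 < x → ContDiffAt ℝ (⊤ : ℕ∞) g x := by
    intro x hx
    exact hsm.contDiffAt.comp x
      (((Real.contDiffAt_log.2 hx.ne').div_const _).sub contDiffAt_const)
  refine ⟨φ, ?_, hg1, ?_, ?_, ?_⟩
  · rw [contDiff_iff_contDiffAt]
    intro x
    by_cases h : 0 < x
    · exact (hgs x h).congr_of_eventuallyEq (hpos x h)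
    · have : φ =ᶠ[nhds x] fun _ => 1 := by
        filter_upwards [Iio_mem_nhds (show x < ε ^ 2 by nlinarith [sq_pos_of_pos he0])] with y hy
        exact hg1 y (le_of_lt hy)
      exact contDiffAt_const.congr_of_eventuallyEq this
  · intro x hx
    have h : 0 < x := by linarith
    simp only [φ, not_le.2 h, if_false, g]
    apply Real.smoothTransition.zero_of_nonpos
    have := Real.log_le_log he0 hx
    have : Real.log x / Real.log ε ≤ 1 := by rw [div_le_iff_of_neg hl]; linarith
    linarith
  · intro x
    by_cases h : x ≤ 0
    · simp [φ, h]
    · simp only [φ, h, if_false, g]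
      rw [abs_of_nonneg (Real.smoothTransition.nonneg _)]
      exact Real.smoothTransition.le_one _
  · intro x hx
    rw [(hpos x hx).deriv_eq]
    have : HasDerivAt g (deriv Real.smoothTransition (Real.log x / Real.log ε - 1) *
        (x⁻¹ / Real.log ε)) x :=
      (hd _).hasDerivAt.comp x (((Real.hasDerivAt_log hx.ne').div_const _).sub_const 1)
    rw [this.deriv, abs_mul, abs_div, abs_of_neg hl, abs_of_pos (inv_pos.2 hx)]
    have e : max K 1 / (x * -Real.log ε) = max K 1 * (x⁻¹ / -Real.log ε) := by
      field_simp
    rw [e]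
    have : 0 < -Real.log ε := by linarith
    gcongr
    exact hK' _

/-- Appendix C cut-off function construction: for every integer `n ≥ 3` there are
constants `C > 0` and `ε₀ ∈ (0,1)` such that for every `ε ∈ (0, ε₀)` there is a smooth
function `φ_ε : ℝ → ℝ` which equals `1` on `(-∞, ε²)`, vanishes on `(ε, ∞)`, is bounded
by `C`, has `|φ_ε'(x)| ≤ C/(x |ln x|)` on `(0,1)`, and whose derivative has vanishing
`(n-2)`-nd moment on `(0, ∞)`. -/
theorem cutoff_construction (n : ℕ) (hn : 3 ≤ n) :
    ∃ C : ℝ, 0 < C ∧ ∃ ε₀ ∈ Set.Ioo (0:ℝ) 1, ∀ ε ∈ Set.Ioo (0:ℝ) ε₀,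
      ∃ φ : ℝ → ℝ, ContDiff ℝ (⊤ : ℕ∞) φ ∧
        (∀ x : ℝ, x < ε ^ 2 → φ x = 1) ∧
        (∀ x : ℝ, ε < x → φ x = 0) ∧
        (∀ x : ℝ, |φ x| ≤ C) ∧
        (∀ x ∈ Set.Ioo (0:ℝ) 1, |deriv φ x| ≤ C / (x * |Real.log x|)) ∧
        (∫ x in Set.Ioi (0:ℝ), deriv φ x * x ^ (n - 2)) = 0 := by
  obtain ⟨m, hm⟩ : ∃ m, n - 2 = m + 1 := ⟨n - 3, by omega⟩
  rw [hm]
  obtain ⟨b, hbs, hbc, hblo, hbhi, hb1, ⟨B, hB0, hB⟩, hA⟩ := aux_bump (m + 1) (by omega)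
  obtain ⟨K, hK0, hK⟩ := aux_base
  set A := ∫ x in Set.Ioi (0:ℝ), deriv b x * x ^ (m + 1) with hAdef
  have hA' : 0 < |A| := abs_pos.2 hA
  refine ⟨1 + 2 * K / |A| + 2 * (K + K / |A| * B), by positivity, 1/2,
    ⟨by norm_num, by norm_num⟩, ?_⟩
  rintro ε ⟨he0, he1⟩
  obtain ⟨φ, hφs, hφ1, hφ0, hφb, hφd⟩ := hK ε ⟨he0, he1⟩
  have hl : 1/2 ≤ -Real.log ε := by
    have h1 := Real.log_le_log he0 he1.le
    have h2 : Real.log (1/2) = - Real.log 2 := by rw [one_div, Real.log_inv]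
    have := Real.log_two_gt_d9
    linarith
  have hl0 : 0 < -Real.log ε := by linarith
  have hdφ : Differentiable ℝ φ := hφs.differentiable (by simp)
  have hdb : Differentiable ℝ b := hbs.differentiable (by simp)
  have hcφ : Continuous (deriv φ) := hφs.continuous_deriv (by simp)
  have hcb : Continuous (deriv b) := hbs.continuous_deriv (by simp)
  have hφd0 : ∀ x, ε < x → deriv φ x = 0 := by
    intro x hx
    have : φ =ᶠ[nhds x] fun _ => 0 := by
      filter_upwards [Ioi_mem_nhds hx] with y hy
      exact hφ0 y (le_of_lt hy)
    rw [this.deriv_eq]; simp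
  have hbd0 : ∀ x, 1 < x → deriv b x = 0 := by
    intro x hx
    have : b =ᶠ[nhds x] fun _ => 0 := by
      filter_upwards [Ioi_mem_nhds hx] with y hy
      exact hbhi y (le_of_lt hy)
    rw [this.deriv_eq]; simp
  -- moment of φ
  set M := ∫ x in Set.Ioi (0:ℝ), deriv φ x * x ^ (m + 1) with hMdef
  have hM0 : M = ∫ x in Set.Ioc 0 ε, deriv φ x * x ^ (m + 1) := by
    rw [hMdef]
    apply setIntegral_eq_of_subset_of_forall_sdiff_eq_zero measurableSet_Ioi
    · exact fun x hx => hx.1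
    · rintro x ⟨hx, hx'⟩
      have : ε < x := by
        by_contra h
        exact hx' ⟨hx, not_lt.1 h⟩
      rw [hφd0 x this, zero_mul]
  have hM : |M| ≤ K / (-Real.log ε) * ε ^ (m + 1) := by
    have h := norm_setIntegral_le_of_norm_le_const (μ := volume) (s := Set.Ioc 0 ε)
      (f := fun x => deriv φ x * x ^ (m + 1)) (C := K / (-Real.log ε) * ε ^ m)
      (by simp) (by
        rintro x ⟨hx, hx'⟩
        rw [Real.norm_eq_abs, abs_mul, abs_of_pos (pow_pos hx _)]
        calc _ ≤ K / (x * (-Real.log ε)) * x ^ (m + 1) := by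
                gcongr
                exact hφd x hx
          _ = K / (-Real.log ε) * x ^ m := by rw [pow_succ]; field_simp
          _ ≤ _ := by gcongr)
    rw [hM0, ← Real.norm_eq_abs]
    refine h.trans (le_of_eq ?_)
    simp [Measure.real, he0.le]
    ring
  -- integrability
  have iφ : IntegrableOn (fun x => deriv φ x * x ^ (m + 1)) (Set.Ioi (0:ℝ)) := by
    have : IntegrableOn (fun x => deriv φ x * x ^ (m + 1)) (Set.Icc (0:ℝ) ε) :=
      (hcφ.mul (continuous_pow _)).continuousOn.integrableOn_Icc
    apply this.of_forall_sdiff_eq_zero measurableSet_Ioi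
    rintro x ⟨hx, hx'⟩
    have : ε < x := by
      by_contra h
      exact hx' ⟨le_of_lt hx, not_lt.1 h⟩
    rw [hφd0 x this, zero_mul]
  have iη : IntegrableOn (fun x => deriv b (ε⁻¹ * x) * ε⁻¹ * x ^ (m + 1)) (Set.Ioi (0:ℝ)) := by
    have : IntegrableOn (fun x => deriv b (ε⁻¹ * x) * ε⁻¹ * x ^ (m + 1)) (Set.Icc (0:ℝ) ε) := by
      apply ContinuousOn.integrableOn_Icc
      apply Continuous.continuousOn
      fun_prop
    apply this.of_forall_sdiff_eq_zero measurableSet_Ioi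
    rintro x ⟨hx, hx'⟩
    have : ε < x := by
      by_contra h
      exact hx' ⟨le_of_lt hx, not_lt.1 h⟩
    rw [hbd0 _ (by rw [inv_mul_eq_div, lt_div_iff₀ he0]; linarith)]
    simp
  have hη : (∫ x in Set.Ioi (0:ℝ), deriv b (ε⁻¹ * x) * ε⁻¹ * x ^ (m + 1)) = ε ^ (m + 1) * A := by
    have h := integral_comp_mul_left_Ioi
      (fun u => ε ^ m * (deriv b u * u ^ (m + 1))) 0 (inv_pos.2 he0)
    rw [mul_zero, integral_const_mul (ε ^ m) (fun u => deriv b u * u ^ (m + 1)), ← hAdef, inv_inv,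
      smul_eq_mul] at h
    rw [show ε ^ (m + 1) * A = ε * (ε ^ m * A) by ring, ← h]
    congr 1
    ext x
    rw [mul_pow, pow_succ, pow_succ, inv_pow]
    field_simp
  let c : ℝ := M / (ε ^ (m + 1) * A)
  have hc : |c| ≤ K / |A| / (-Real.log ε) := by
    have : 0 < ε ^ (m + 1) := by positivity
    simp only [c]
    rw [abs_div, abs_mul, abs_of_pos this, div_le_iff₀ (by positivity)]
    refine hM.trans (le_of_eq ?_)
    field_simp
  have hder : ∀ x, HasDerivAt (fun x => φ x - c * b (ε⁻¹ * x))
      (deriv φ x - c * (deriv b (ε⁻¹ * x) * ε⁻¹)) x := by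
    intro x
    have h1 : HasDerivAt (fun x : ℝ => ε⁻¹ * x) ε⁻¹ x := by
      simpa using (hasDerivAt_id x).const_mul ε⁻¹
    have h2 : HasDerivAt (fun x => b (ε⁻¹ * x)) (deriv b (ε⁻¹ * x) * ε⁻¹) x :=
      (hdb _).hasDerivAt.comp x h1
    exact (hdφ x).hasDerivAt.sub (h2.const_mul c)
  have hone : ∀ x : ℝ, x < ε ^ 2 → φ x - c * b (ε⁻¹ * x) = 1 := by
    intro x hx
    rw [hφ1 x hx.le, hblo]
    · simp
    · rw [inv_mul_eq_div, div_le_iff₀ he0]; nlinarith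
  have hzero : ∀ x : ℝ, ε < x → φ x - c * b (ε⁻¹ * x) = 0 := by
    intro x hx
    rw [hφ0 x hx.le, hbhi]
    · simp
    · rw [inv_mul_eq_div, le_div_iff₀ he0]; linarith
  refine ⟨fun x => φ x - c * b (ε⁻¹ * x), ?_, hone, hzero, ?_, ?_, ?_⟩
  · exact hφs.sub (contDiff_const.mul (hbs.comp (contDiff_const.mul contDiff_id)))
  · intro x
    have h1 : |c| ≤ 2 * K / |A| := by
      refine hc.trans ?_
      rw [div_le_iff₀ hl0]
      have : 0 < K / |A| := by positivity
      rw [mul_div_assoc]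
      nlinarith
    have h2 : |c * b (ε⁻¹ * x)| ≤ |c| := by
      rw [abs_mul]
      exact mul_le_of_le_one_right (abs_nonneg _) (hb1 _)
    have h3 := abs_sub (φ x) (c * b (ε⁻¹ * x))
    have h4 := hφb x
    have : 0 < 2 * (K + K / |A| * B) := by positivity
    linarith
  · rintro x ⟨hx0, hx1⟩
    have hR : 0 ≤ (1 + 2 * K / |A| + 2 * (K + K / |A| * B)) / (x * |Real.log x|) := by
      positivity
    by_cases ha : x < ε ^ 2
    · have : (fun x => φ x - c * b (ε⁻¹ * x)) =ᶠ[nhds x] fun _ => 1 := by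
        filter_upwards [Iio_mem_nhds ha] with y hy
        exact hone y hy
      rw [this.deriv_eq]; simpa using hR
    by_cases hb : ε < x
    · have : (fun x => φ x - c * b (ε⁻¹ * x)) =ᶠ[nhds x] fun _ => 0 := by
        filter_upwards [Ioi_mem_nhds hb] with y hy
        exact hzero y hy
      rw [this.deriv_eq]; simpa using hR
    rw [not_lt] at ha hb
    have hlx : Real.log x < 0 := Real.log_neg hx0 hx1
    have hlx2 : -Real.log x ≤ 2 * (-Real.log ε) := by
      have := Real.log_le_log (by positivity) ha
      rw [Real.log_pow] at this
      push_cast at this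
      linarith
    rw [(hder x).deriv, abs_of_neg hlx]
    have hlx0 : 0 < -Real.log x := by linarith
    have h1 : |c * (deriv b (ε⁻¹ * x) * ε⁻¹)| ≤ K / |A| / (-Real.log ε) * (B * x⁻¹) := by
      rw [abs_mul, abs_mul, abs_of_pos (inv_pos.2 he0)]
      gcongr
      exact hB _
    calc _ ≤ |deriv φ x| + |c * (deriv b (ε⁻¹ * x) * ε⁻¹)| := abs_sub _ _
      _ ≤ K / (x * (-Real.log ε)) + K / |A| / (-Real.log ε) * (B * x⁻¹) :=
          add_le_add (hφd x hx0) h1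
      _ = 2 * (K + K / |A| * B) / (x * (2 * (-Real.log ε))) := by
          generalize -Real.log ε = l at *
          field_simp
      _ ≤ 2 * (K + K / |A| * B) / (x * (-Real.log x)) := by gcongr
      _ ≤ _ := by
          gcongr
          have : 0 < 2 * K / |A| := by positivity
          linarith
  · have : (fun x => deriv (fun x => φ x - c * b (ε⁻¹ * x)) x * x ^ (m + 1)) =
        fun x => deriv φ x * x ^ (m + 1) - c * (deriv b (ε⁻¹ * x) * ε⁻¹ * x ^ (m + 1)) := by
      ext x
      rw [(hder x).deriv]; ring
    rw [this, integral_sub iφ (iη.const_mul c), integral_const_mul, hη, ← hMdef]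
    have : ε ^ (m + 1) * A ≠ 0 := mul_ne_zero (by positivity) hA
    simp only [c]
    rw [div_mul_cancel₀ _ this, sub_self]
end

section
/- Let n ≥ 3 be an integer, ε ∈ (0,1), and C > 0. Let φ : ℝ → ℝ be continuously differentiable with φ′(x) = 0 whenever x ≤ ε² or x ≥ ε, with |φ′(x)| ≤ C/(x·|ln x|) for all x ∈ (0,1), and with ∫₀^∞ φ′(s)·s^{n−2} ds = 0. Define Ξ(x) = ∫₀^x φ′(s)·s^{n−2} ds for x > 0. Then Ξ(x) = 0 for all x ≤ ε² and for all x ≥ ε, and |Ξ(x)| ≤ C·x^{n−2}/((n−2)·|ln ε|) for all x ∈ (0, ε]. -/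
open MeasureTheory

/-- Property (7XII17.1) in Step 1 of the proof of the deformation theorem:
`Ξ(x) = ∫₀^x φ'(s) s^{n-2} ds` vanishes for `x ≤ ε²` and for `x ≥ ε`, and admits
the bound `|Ξ(x)| ≤ C x^{n-2}/((n-2)|ln ε|)` on `(0, ε]`. -/
theorem Xi_support_and_bound (n : ℕ) (hn : 3 ≤ n) (ε C : ℝ)
    (hε : ε ∈ Set.Ioo (0:ℝ) 1) (hC : 0 < C)
    (φ : ℝ → ℝ) (hφ : ContDiff ℝ 1 φ)
    (hsupp : ∀ x : ℝ, (x ≤ ε ^ 2 ∨ ε ≤ x) → deriv φ x = 0)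
    (hbound : ∀ x ∈ Set.Ioo (0:ℝ) 1, |deriv φ x| ≤ C / (x * |Real.log x|))
    (hmoment : (∫ s in Set.Ioi (0:ℝ), deriv φ s * s ^ (n - 2)) = 0)
    (Ξ : ℝ → ℝ)
    (hΞ : ∀ x : ℝ, 0 < x → Ξ x = ∫ s in Set.Ioc (0:ℝ) x, deriv φ s * s ^ (n - 2)) :
    (∀ x : ℝ, 0 < x → x ≤ ε ^ 2 → Ξ x = 0) ∧
    (∀ x : ℝ, ε ≤ x → Ξ x = 0) ∧
    (∀ x ∈ Set.Ioc (0:ℝ) ε,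
      |Ξ x| ≤ C * x ^ (n - 2) / (((n:ℝ) - 2) * |Real.log ε|)) := by
  obtain ⟨k, rfl⟩ : ∃ k, n = k + 3 := ⟨n - 3, by omega⟩
  obtain ⟨h0, h1⟩ := hε
  have e2 : k + 3 - 2 = k + 1 := by omega
  simp only [e2] at hmoment hΞ ⊢
  refine ⟨?_, ?_, ?_⟩
  · intro x hx hxe
    rw [hΞ x hx]
    apply setIntegral_eq_zero_of_forall_eq_zero
    intro s hs
    rw [hsupp s (Or.inl (hs.2.trans hxe)), zero_mul]
  · intro x hx
    rw [hΞ x (h0.trans_le hx)]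
    refine Eq.trans (Eq.symm ?_) hmoment
    apply setIntegral_eq_of_subset_of_forall_sdiff_eq_zero measurableSet_Ioi
    · intro s hs
      exact hs.1
    · intro s hs
      have : x < s := by
        by_contra h
        exact hs.2 ⟨hs.1, not_lt.mp h⟩
      rw [hsupp s (Or.inr (hx.trans this.le)), zero_mul]
  · rintro x ⟨hx, hxe⟩
    rw [hΞ x hx]
    have hL : 0 < |Real.log ε| := abs_pos.mpr (Real.log_neg h0 h1).ne
    have hint : (∫ s in Set.Ioc (0:ℝ) x, C / |Real.log ε| * s ^ k)
        = C * x ^ (k + 1) / ((((k + 3 : ℕ) : ℝ) - 2) * |Real.log ε|) := by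
      rw [← intervalIntegral.integral_of_le hx.le, intervalIntegral.integral_const_mul,
        integral_pow]
      have : (((k + 3 : ℕ) : ℝ) - 2) = k + 1 := by push_cast; ring
      rw [this]
      have : (k : ℝ) + 1 ≠ 0 := by positivity
      field_simp
      simp
    rw [← hint, ← Real.norm_eq_abs]
    apply norm_integral_le_of_norm_le
    · have : Continuous fun s : ℝ => C / |Real.log ε| * s ^ k := by fun_prop
      exact this.integrableOn_Ioc
    · refine (ae_restrict_iff' measurableSet_Ioc).mpr (Filter.Eventually.of_forall ?_)
      rintro s ⟨hs, hsx⟩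
      have hse := hsx.trans hxe
      have hlog : |Real.log ε| ≤ |Real.log s| := by
        rw [abs_of_neg (Real.log_neg h0 h1), abs_of_neg (Real.log_neg hs (hse.trans_lt h1))]
        exact neg_le_neg (Real.log_le_log hs hse)
      rw [Real.norm_eq_abs, abs_mul, abs_of_pos (pow_pos hs _)]
      calc |deriv φ s| * s ^ (k + 1) ≤ C / (s * |Real.log ε|) * s ^ (k + 1) := by
            gcongr
            refine (hbound s ⟨hs, hse.trans_lt h1⟩).trans ?_
            gcongr
        _ = C / |Real.log ε| * s ^ k := by
            field_simp
            ring
end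

section
/- Let n ≥ 1 be an integer, α ∈ ℝ, and let e ∈ ℝⁿ be a unit vector. Extend Φ_{α,e}^∞ by the same formula to the open set {w ∈ ℝⁿ : cosh(α) + sinh(α)·⟨e,w⟩ > 0}. Then for every θ ∈ S^{n−1} and every v ∈ ℝⁿ with ⟨v, θ⟩ = 0 (i.e. v tangent to the sphere at θ), the Fréchet derivative of Φ_{α,e}^∞ at θ satisfies |DΦ_{α,e}^∞(θ)[v]| = |v| / (cosh(α) + sinh(α)·⟨e,θ⟩). In other words, Φ_{α,e}^∞ is a conformal transformation of the round sphere, scaling tangent vectors at θ by the factor (cosh(α) + sinh(α)·⟨e,θ⟩)^{−1}. -/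
open scoped RealInnerProductSpace

/-- The boundary action at infinity `Φ_{α,e}^∞`, extended by the same formula to
the open set `{w : cosh α + sinh α ⟨e,w⟩ > 0}` (Section 3.4). -/
noncomputable def PhiInf {n : ℕ} (α : ℝ) (e : EuclideanSpace ℝ (Fin n))
    (w : EuclideanSpace ℝ (Fin n)) : EuclideanSpace ℝ (Fin n) :=
  (Real.cosh α + Real.sinh α * ⟪e, w⟫)⁻¹ •
    ((Real.sinh α + Real.cosh α * ⟪e, w⟫) • e + (w - ⟪e, w⟫ • e))

/-- Quantitative form of (9VIII17.C1): `Φ_{α,e}^∞` is a conformal transformation of the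
round sphere, scaling tangent vectors at `θ` by the factor
`(cosh α + sinh α ⟨e,θ⟩)⁻¹`: for `θ` on the unit sphere and `v` tangent at `θ`,
`|DΦ_{α,e}^∞(θ)[v]| = |v| / (cosh α + sinh α ⟨e,θ⟩)`. -/
theorem PhiInf_fderiv_conformal (n : ℕ) (hn : 1 ≤ n) (α : ℝ)
    (e : EuclideanSpace ℝ (Fin n)) (he : ‖e‖ = 1)
    (θ : EuclideanSpace ℝ (Fin n))
    (hθ : θ ∈ Metric.sphere (0 : EuclideanSpace ℝ (Fin n)) 1)
    (v : EuclideanSpace ℝ (Fin n)) (hv : ⟪v, θ⟫ = 0) :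
    ‖fderiv ℝ (PhiInf α e) θ v‖ = ‖v‖ / (Real.cosh α + Real.sinh α * ⟪e, θ⟫) := by
  have hθ1 : ‖θ‖ = 1 := by simpa using hθ
  have hcs := Real.cosh_sq_sub_sinh_sq α
  have hc := Real.cosh_pos α
  have ht := abs_real_inner_le_norm e θ
  rw [he, hθ1, mul_one] at ht
  have hD : 0 < Real.cosh α + Real.sinh α * ⟪e, θ⟫ := by
    have h1 : |Real.sinh α| < Real.cosh α := abs_lt_of_sq_lt_sq (by linarith) hc.le
    have h2 : |Real.sinh α * ⟪e, θ⟫| ≤ |Real.sinh α| := by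
      rw [abs_mul]
      exact mul_le_of_le_one_right (abs_nonneg _) ht
    have h3 := neg_abs_le (Real.sinh α * ⟪e, θ⟫)
    linarith
  have hi : HasFDerivAt (fun w : EuclideanSpace ℝ (Fin n) => ⟪e, w⟫) (innerSL ℝ e) θ :=
    (innerSL ℝ e).hasFDerivAt
  have hden := (hi.const_mul (Real.sinh α)).const_add (Real.cosh α)
  have hnum := (((hi.const_mul (Real.cosh α)).const_add (Real.sinh α)).smul_const e).add
    ((hasFDerivAt_id θ).sub (hi.smul_const e))
  have hinv := (hasDerivAt_inv hD.ne').comp_hasFDerivAt θ hden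
  have hF := hinv.smul hnum
  have hfd := HasFDerivAt.fderiv (f := PhiInf α e) hF
  have hval : fderiv ℝ (PhiInf α e) θ v = (Real.cosh α + Real.sinh α * ⟪e, θ⟫)⁻¹ •
      (v + (⟪e, v⟫ * (1 - Real.cosh α) / (Real.cosh α + Real.sinh α * ⟪e, θ⟫)) • e
        + (-(Real.sinh α * ⟪e, v⟫) / (Real.cosh α + Real.sinh α * ⟪e, θ⟫)) • θ) := by
    rw [hfd]
    simp
    generalize ⟪e, θ⟫ = t at *
    generalize ⟪e, v⟫ = p at *
    match_scalars
    all_goals field_simp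
    all_goals try linear_combination (p) * hcs
  rw [hval, norm_smul, norm_inv, Real.norm_of_nonneg hD.le, div_eq_inv_mul ‖v‖]
  congr 1
  rw [← sq_eq_sq₀ (norm_nonneg _) (norm_nonneg _)]
  rw [norm_add_sq_real, norm_add_sq_real, norm_smul, norm_smul, inner_add_left]
  simp only [inner_smul_left, inner_smul_right, he, hθ1, hv, mul_one, Real.norm_eq_abs, sq_abs,
    real_inner_comm e v]
  simp only [conj_trivial]
  generalize ⟪e, θ⟫ = t at *
  generalize ⟪e, v⟫ = p at *
  generalize ‖v‖ = q at *
  field_simp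
  linear_combination (-p ^ 2) * hcs
end

section
/- Let n ≥ 2 be an integer and let (v₀, v₁, …, v_n) ∈ ℝ^{1+n} satisfy v₀ > √(v₁² + ⋯ + v_n²) (a future-pointing timelike covector). Then there exists a smooth function η : ℝⁿ → ℝ which is nonnegative at every point of the unit sphere S^{n−1} ⊂ ℝⁿ and satisfies ∫_{S^{n−1}} η dσ = v₀ and ∫_{S^{n−1}} η(θ)·θ_i dσ(θ) = v_i for each i = 1, …, n, where θ_i denotes the i-th Euclidean coordinate of θ. -/
open MeasureTheory

section Aux

open Module

variable {n : ℕ}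

theorem aux_finrank (hn : 2 ≤ n) {e : EuclideanSpace ℝ (Fin n)} (he : ‖e‖ = 1) :
    ((finrank ℝ (Submodule.span ℝ {e})ᗮ : ℕ) : ℝ) = (n : ℝ) - 1 := by
  have : Fact (finrank ℝ (EuclideanSpace ℝ (Fin n)) = (n - 1) + 1) := ⟨by simp; omega⟩
  have he0 : e ≠ 0 := by
    rintro rfl
    simp at he
  rw [Submodule.finrank_orthogonal_span_singleton (n := n - 1) he0]
  rw [Nat.cast_sub (by omega)]
  simp

theorem aux_half (hn : 2 ≤ n) {e : EuclideanSpace ℝ (Fin n)} (he : ‖e‖ = 1) :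
    μH[(n:ℝ) - 1] {x : EuclideanSpace ℝ (Fin n) | ‖x‖ = 1 ∧ inner ℝ e x ≤ 0} < ⊤ := by
  have hd0 : (0:ℝ) ≤ (n:ℝ) - 1 := by
    have : (2:ℝ) ≤ n := by exact_mod_cast hn
    linarith
  let g : (Submodule.span ℝ {e})ᗮ → EuclideanSpace ℝ (Fin n) := fun w => stereoInvFunAux e w
  have hg : ContDiff ℝ 1 g :=
    contDiff_stereoInvFunAux.comp (Submodule.span ℝ {e})ᗮ.subtypeL.contDiff
  obtain ⟨K, hK⟩ := (hg.locallyLipschitz.locallyLipschitzOn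
    (s := Metric.closedBall 0 2)).exists_lipschitzOnWith_of_compact (isCompact_closedBall _ _)
  have hsub : {x : EuclideanSpace ℝ (Fin n) | ‖x‖ = 1 ∧ inner ℝ e x ≤ 0} ⊆
      g '' Metric.closedBall 0 2 := by
    rintro x ⟨hx1, hx2⟩
    have hxe : x ≠ e := by
      rintro rfl
      rw [real_inner_self_eq_norm_sq, hx1] at hx2
      norm_num at hx2
    refine ⟨stereoToFun e x, ?_, ?_⟩
    · rw [mem_closedBall_zero_iff, stereoToFun_apply, norm_smul, innerSL_apply_apply]
      have h1 : ‖(2:ℝ) / (1 - inner ℝ e x)‖ ≤ 2 := by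
        rw [Real.norm_eq_abs, abs_of_pos (by apply div_pos <;> linarith),
          div_le_iff₀ (by linarith)]
        linarith
      have h2 := (Submodule.span ℝ {e})ᗮ.norm_orthogonalProjectionOnto_apply_le x
      rw [hx1] at h2
      calc _ ≤ (2:ℝ) * 1 := mul_le_mul h1 h2 (norm_nonneg _) (by norm_num)
        _ = 2 := by norm_num
    · have := stereo_left_inv he (x := ⟨x, by simpa using hx1⟩) hxe
      exact congrArg Subtype.val this
  refine (measure_mono hsub).trans_lt ?_
  refine (hK.hausdorffMeasure_image_le hd0).trans_lt ?_
  refine ENNReal.mul_lt_top (ENNReal.rpow_lt_top_of_nonneg hd0 (by simp)) ?_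
  rw [← aux_finrank hn he]
  exact (isCompact_closedBall _ _).measure_lt_top

theorem aux_finite (hn : 2 ≤ n) {e : EuclideanSpace ℝ (Fin n)} (he : ‖e‖ = 1) :
    μH[(n:ℝ) - 1] (Metric.sphere (0 : EuclideanSpace ℝ (Fin n)) 1) < ⊤ := by
  have h1 := aux_half hn he
  have h2 := aux_half hn (e := -e) (by simpa using he)
  refine (measure_mono ?_).trans_lt ((measure_union_le _ _).trans_lt (ENNReal.add_lt_top.2 ⟨h1, h2⟩))
  intro x hx
  have hx : ‖x‖ = 1 := by simpa using hx
  rcases le_total (inner ℝ e x) 0 with h | h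
  · exact Or.inl ⟨hx, h⟩
  · exact Or.inr ⟨hx, by simpa [inner_neg_left] using h⟩

theorem aux_cap (hn : 2 ≤ n) {e : EuclideanSpace ℝ (Fin n)} (he : ‖e‖ = 1)
    {c : ℝ} (hc0 : 0 < c) (hc : c < 1) :
    0 < μH[(n:ℝ) - 1] {x : EuclideanSpace ℝ (Fin n) | c < inner ℝ e x ∧ ‖x‖ = 1} := by
  have hd0 : (0:ℝ) ≤ (n:ℝ) - 1 := by
    have : (2:ℝ) ≤ n := by exact_mod_cast hn
    linarith
  refine lt_of_lt_of_le ?_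
    (hausdorffMeasure_orthogonalProjectionOnto_le (𝕜 := ℝ) (Submodule.span ℝ {e})ᗮ _ _ hd0)
  rw [← aux_finrank hn he]
  have hr : 0 < 1 - c ^ 2 := by nlinarith
  refine lt_of_lt_of_le (Metric.measure_ball_pos _ 0 (Real.sqrt_pos.2 hr)) (measure_mono ?_)
  intro y hy
  rw [mem_ball_zero_iff, Real.lt_sqrt (norm_nonneg _)] at hy
  have hey : inner ℝ e (y : EuclideanSpace ℝ (Fin n)) = 0 :=
    Submodule.mem_orthogonal_singleton_iff_inner_right.1 y.2
  have hs : Real.sqrt (1 - ‖y‖ ^ 2) ^ 2 = 1 - ‖y‖ ^ 2 := Real.sq_sqrt (by nlinarith)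
  refine ⟨(y : EuclideanSpace ℝ (Fin n)) + Real.sqrt (1 - ‖y‖ ^ 2) • e, ⟨?_, ?_⟩, ?_⟩
  · rw [inner_add_right, hey, inner_smul_right, real_inner_self_eq_norm_sq, he]
    rw [zero_add, one_pow, mul_one]
    apply Real.lt_sqrt_of_sq_lt
    linarith
  · have : ‖(y : EuclideanSpace ℝ (Fin n)) + Real.sqrt (1 - ‖y‖ ^ 2) • e‖ ^ 2 = 1 := by
      rw [norm_add_sq_real, inner_smul_right, real_inner_comm, hey, norm_smul, he, mul_one,
        Real.norm_eq_abs, sq_abs, hs, Submodule.coe_norm]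
      ring
    exact (pow_eq_one_iff_of_nonneg (norm_nonneg _) two_ne_zero).1 this
  · rw [map_add, map_smul, Submodule.orthogonalProjectionOnto_mem_subspace_eq_self,
      Submodule.orthogonalProjectionOnto_orthogonal_apply_eq_zero
        (Submodule.mem_span_singleton_self e)]
    simp

theorem aux_inv (R : EuclideanSpace ℝ (Fin n) ≃ₗᵢ[ℝ] EuclideanSpace ℝ (Fin n)) (d : ℝ)
    (f : EuclideanSpace ℝ (Fin n) → ℝ) :
    ∫ θ in Metric.sphere (0 : EuclideanSpace ℝ (Fin n)) 1, f (R θ) ∂(μH[d]) =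
    ∫ θ in Metric.sphere (0 : EuclideanSpace ℝ (Fin n)) 1, f θ ∂(μH[d]) := by
  have := (R.toIsometryEquiv.measurePreserving_hausdorffMeasure d).setIntegral_preimage_emb
    R.toIsometryEquiv.toHomeomorph.measurableEmbedding f
    (Metric.sphere (0 : EuclideanSpace ℝ (Fin n)) 1)
  rw [← this]
  have h : R.toIsometryEquiv ⁻¹' (Metric.sphere (0 : EuclideanSpace ℝ (Fin n)) 1) =
      Metric.sphere (0 : EuclideanSpace ℝ (Fin n)) 1 := by
    ext x; simp
  rw [h]
  rfl

theorem aux_integrable (hn : 2 ≤ n) {e : EuclideanSpace ℝ (Fin n)} (he : ‖e‖ = 1)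
    {f : EuclideanSpace ℝ (Fin n) → ℝ} (hf : Continuous f) :
    IntegrableOn f (Metric.sphere (0 : EuclideanSpace ℝ (Fin n)) 1) (μH[(n:ℝ) - 1]) :=
  hf.continuousOn.integrableOn_of_subset_isCompact (isCompact_sphere _ _)
    Metric.isClosed_sphere.measurableSet le_rfl (aux_finite hn he).ne

theorem aux_first (hn : 2 ≤ n) {e : EuclideanSpace ℝ (Fin n)} (he : ‖e‖ = 1)
    {f : ℝ → ℝ} (hf : Continuous f) (i : Fin n) :
    ∫ θ in Metric.sphere (0 : EuclideanSpace ℝ (Fin n)) 1, f (inner ℝ e θ) * θ i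
      ∂(μH[(n:ℝ) - 1]) =
    (∫ θ in Metric.sphere (0 : EuclideanSpace ℝ (Fin n)) 1, f (inner ℝ e θ) * inner ℝ e θ
      ∂(μH[(n:ℝ) - 1])) * e i := by
  have h := aux_inv (Submodule.reflection (Submodule.span ℝ {e})) ((n:ℝ) - 1)
    (fun θ => f (inner ℝ e θ) * θ i)
  have hR : ∀ θ : EuclideanSpace ℝ (Fin n), Submodule.reflection (Submodule.span ℝ {e}) θ =
      (2 * inner ℝ e θ) • e - θ := by
    intro θ
    rw [Submodule.reflection_singleton_apply, he]
    simp [mul_smul, two_smul]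
  have hI : ∀ θ : EuclideanSpace ℝ (Fin n),
      inner ℝ e (Submodule.reflection (Submodule.span ℝ {e}) θ) = inner ℝ e θ := by
    intro θ
    rw [hR, inner_sub_right, inner_smul_right, real_inner_self_eq_norm_sq, he]
    ring
  have hc : ∀ θ : EuclideanSpace ℝ (Fin n),
      f (inner ℝ e (Submodule.reflection (Submodule.span ℝ {e}) θ)) *
        (Submodule.reflection (Submodule.span ℝ {e}) θ) i =
      (2 * e i) * (f (inner ℝ e θ) * inner ℝ e θ) - f (inner ℝ e θ) * θ i := by
    intro θ
    rw [hI, hR]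
    simp
    ring
  simp only [hc] at h
  rw [integral_sub, integral_const_mul] at h
  · linarith
  · exact (aux_integrable hn he (by fun_prop)).const_mul _
  · exact aux_integrable hn he (by fun_prop)

theorem aux_main (hn : 2 ≤ n) {e : EuclideanSpace ℝ (Fin n)} (he : ‖e‖ = 1)
    (v₀ r : ℝ) (hr : 0 ≤ r) (hrv : r < v₀) :
    ∃ η : EuclideanSpace ℝ (Fin n) → ℝ, ContDiff ℝ (⊤ : ℕ∞) η ∧
      (∀ θ ∈ Metric.sphere (0 : EuclideanSpace ℝ (Fin n)) 1, 0 ≤ η θ) ∧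
      (∫ θ in Metric.sphere (0 : EuclideanSpace ℝ (Fin n)) 1, η θ ∂(μH[(n:ℝ) - 1])) = v₀ ∧
      (∀ i : Fin n,
        (∫ θ in Metric.sphere (0 : EuclideanSpace ℝ (Fin n)) 1, η θ * θ i
          ∂(μH[(n:ℝ) - 1])) = r * e i) := by
  have hv0 : 0 < v₀ := by linarith
  have hq : r / v₀ < 1 := (div_lt_one hv0).2 hrv
  have hq0 : 0 ≤ r / v₀ := by positivity
  obtain ⟨c, hcq, hc1⟩ := exists_between hq
  have hc0 : 0 < c := by linarith
  have hrc : r ≤ c * v₀ := ((div_lt_iff₀ hv0).1 hcq).le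
  set S := Metric.sphere (0 : EuclideanSpace ℝ (Fin n)) 1 with hS
  set μ : Measure (EuclideanSpace ℝ (Fin n)) := μH[(n:ℝ) - 1] with hμ
  have hSm : MeasurableSet S := Metric.isClosed_sphere.measurableSet
  let a : ℝ → ℝ := fun t => expNegInvGlue (t - c)
  have ha : ContDiff ℝ (⊤ : ℕ∞) a := expNegInvGlue.contDiff.comp (contDiff_id.sub contDiff_const)
  have hac : Continuous a := ha.continuous
  have ha0 : ∀ t, 0 ≤ a t := fun t => expNegInvGlue.nonneg _
  set M0 := ∫ θ in S, a (inner ℝ e θ) ∂μ with hM0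
  set M1 := ∫ θ in S, a (inner ℝ e θ) * inner ℝ e θ ∂μ with hM1
  have i0 : IntegrableOn (fun θ => a (inner ℝ e θ)) S μ := aux_integrable hn he (by fun_prop)
  have i1 : IntegrableOn (fun θ => a (inner ℝ e θ) * inner ℝ e θ) S μ :=
    aux_integrable hn he (by fun_prop)
  have hcap := aux_cap hn he hc0 hc1
  have hM0pos : 0 < M0 := by
    rw [hM0, setIntegral_pos_iff_support_of_nonneg_ae (Filter.Eventually.of_forall fun θ => ha0 _) i0]
    refine lt_of_lt_of_le hcap (measure_mono ?_)
    rintro x ⟨h1, h2⟩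
    refine ⟨(expNegInvGlue.pos_of_pos (by linarith)).ne', by simpa [hS] using h2⟩
  have hM1c : c * M0 ≤ M1 := by
    rw [hM0, hM1, ← integral_const_mul]
    refine setIntegral_mono (i0.const_mul c) i1 ?_
    intro θ
    rcases le_total (inner ℝ e θ) c with h | h
    · have : a (inner ℝ e θ) = 0 := expNegInvGlue.zero_of_nonpos (by linarith)
      simp [this]
    · have := mul_le_mul_of_nonneg_left h (ha0 (inner ℝ e θ))
      simp only
      linarith
  have hM1pos : 0 < M1 := by
    have := mul_pos hc0 hM0pos
    linarith
  set A := μ.real S with hA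
  have hApos : 0 < A := by
    refine ENNReal.toReal_pos ?_ (aux_finite hn he).ne
    refine (lt_of_lt_of_le hcap (measure_mono ?_)).ne'
    rintro x ⟨h1, h2⟩
    simpa [hS] using h2
  have hodd : ∫ θ in S, (inner ℝ e θ : ℝ) ∂μ = 0 := by
    have := aux_inv (LinearIsometryEquiv.neg ℝ) ((n:ℝ) - 1)
      (fun θ : EuclideanSpace ℝ (Fin n) => (inner ℝ e θ : ℝ))
    simp only [LinearIsometryEquiv.coe_neg, inner_neg_right, integral_neg] at this
    linarith
  let β := r / M1
  let α := (v₀ - β * M0) / A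
  have hβ : 0 ≤ β := by positivity
  have hα : 0 ≤ α := by
    refine div_nonneg ?_ hApos.le
    have : β * M0 ≤ v₀ := by
      rw [div_mul_eq_mul_div, div_le_iff₀ hM1pos]
      nlinarith
    linarith
  refine ⟨fun θ => α + β * a (inner ℝ e θ), ?_, ?_, ?_, ?_⟩
  · exact contDiff_const.add (contDiff_const.mul (ha.comp (innerSL ℝ e).contDiff))
  · intro θ _
    exact add_nonneg hα (mul_nonneg hβ (ha0 _))
  · have hi : IntegrableOn (fun _ => α) S μ := aux_integrable hn he continuous_const
    rw [integral_add hi (i0.const_mul β), integral_const_mul, setIntegral_const, ← hM0,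
      ← hA, smul_eq_mul, mul_div_cancel₀ _ hApos.ne']
    ring
  · intro i
    rw [aux_first hn he (f := fun t => α + β * a t) (by fun_prop) i]
    congr 1
    simp only [add_mul, mul_assoc]
    have hi : IntegrableOn (fun θ => (inner ℝ e θ : ℝ)) S μ := aux_integrable hn he (by fun_prop)
    rw [integral_add (hi.const_mul α) (i1.const_mul β), integral_const_mul, integral_const_mul,
      hodd, ← hM1, mul_zero, zero_add, div_mul_cancel₀ _ hM1pos.ne']

end Aux

/-- Key construction in the proof of Corollary 5.2: any future-pointing timelike covector
`(v₀, v₁, …, v_n)` (i.e. `v₀ > √(v₁² + ⋯ + v_n²)`) is realized as the zeroth and first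
spherical moments of a smooth function `η` which is nonnegative on the unit sphere,
where `σ` is the `(n−1)`-dimensional Hausdorff measure on the sphere. -/
theorem exists_nonneg_function_with_prescribed_moments (n : ℕ) (hn : 2 ≤ n)
    (v₀ : ℝ) (v : EuclideanSpace ℝ (Fin n))
    (hv : Real.sqrt (∑ i, v i ^ 2) < v₀) :
    ∃ η : EuclideanSpace ℝ (Fin n) → ℝ, ContDiff ℝ (⊤ : ℕ∞) η ∧
      (∀ θ ∈ Metric.sphere (0 : EuclideanSpace ℝ (Fin n)) 1, 0 ≤ η θ) ∧
      (∫ θ in Metric.sphere (0 : EuclideanSpace ℝ (Fin n)) 1, η θ ∂(μH[(n:ℝ) - 1])) = v₀ ∧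
      (∀ i : Fin n,
        (∫ θ in Metric.sphere (0 : EuclideanSpace ℝ (Fin n)) 1, η θ * θ i
          ∂(μH[(n:ℝ) - 1])) = v i) := by
  have hnorm : ‖v‖ = Real.sqrt (∑ i, v i ^ 2) := by
    rw [EuclideanSpace.norm_eq]
    simp
  rw [← hnorm] at hv
  have hex : ∃ e : EuclideanSpace ℝ (Fin n), ‖e‖ = 1 ∧ v = ‖v‖ • e := by
    by_cases h : v = 0
    · refine ⟨EuclideanSpace.single ⟨0, by omega⟩ 1, by simp, by simp [h]⟩
    · have h' : ‖v‖ ≠ 0 := norm_ne_zero_iff.2 h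
      refine ⟨‖v‖⁻¹ • v, by simp [norm_smul, h'], by rw [smul_smul, mul_inv_cancel₀ h', one_smul]⟩
  obtain ⟨e, he, hve⟩ := hex
  obtain ⟨η, h1, h2, h3, h4⟩ := aux_main hn he v₀ ‖v‖ (norm_nonneg _) hv
  refine ⟨η, h1, h2, h3, fun i => ?_⟩
  rw [h4 i]
  conv_rhs => rw [hve]
  simp
end
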